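/- The quotient ring B/(t−1)B is commutative, and there is a k-algebra isomorphism from B/(t−1)B onto the polynomial ring k[e,f,h] in three commuting variables sending the images of the generators e, f, h of B to the corresponding variables. -/

import Mathlib

open LaurentPolynomial FreeAlgebra

noncomputable section

/-- Generators `e`, `f`, `h`. -/
inductive Bgen | e | f | h

variable (k : Type*) [Field k] [CharZero k]

/-- The free algebra over the Laurent polynomial ring `k[t,t⁻¹]` on `e, f, h`. -/
abbrev FB := FreeAlgebra (LaurentPolynomial k) Bgen

/-- The defining relations of `B`:
`ef − fe = (t−1)h`, `he − eh = 2(t−1)e`, `hf − fh = −2(t−1)f`. -/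
inductive Brel : FB k → FB k → Prop
  | ef : Brel (ι _ .e * ι _ .f - ι _ .f * ι _ .e)
      (algebraMap (LaurentPolynomial k) (FB k) (T 1 - 1) * ι _ .h)
  | he : Brel (ι _ .h * ι _ .e - ι _ .e * ι _ .h)
      (algebraMap (LaurentPolynomial k) (FB k) (2 * (T 1 - 1)) * ι _ .e)
  | hf : Brel (ι _ .h * ι _ .f - ι _ .f * ι _ .h)
      (-(algebraMap (LaurentPolynomial k) (FB k) (2 * (T 1 - 1))) * ι _ .f)

/-- `B`, the `k[t,t⁻¹]`-algebra generated by `e, f, h` subject to the relations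
`ef − fe = (t−1)h`, `he − eh = 2(t−1)e`, `hf − fh = −2(t−1)f` (the quotient of the
free algebra by the two-sided ideal generated by the relations). -/
abbrev B := RingQuot (Brel k)

/-- The generator `e` of `B`. -/
def Be : B k := RingQuot.mkAlgHom (LaurentPolynomial k) _ (ι _ .e)
/-- The generator `f` of `B`. -/
def Bf : B k := RingQuot.mkAlgHom (LaurentPolynomial k) _ (ι _ .f)
/-- The generator `h` of `B`. -/
def Bh : B k := RingQuot.mkAlgHom (LaurentPolynomial k) _ (ι _ .h)
/-- The image of `t` in `B`. -/
def Bt : B k := algebraMap (LaurentPolynomial k) (B k) (T 1)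

/-- The quotient `B/(t−1)B` of `B` by the (two-sided) ideal generated by `t − 1`. -/
abbrev B1 := ((TwoSidedIdeal.span {Bt k - 1}).ringCon).Quotient

/-- The quotient map `B → B/(t−1)B`. -/
def π : B k →+* B1 k := ((TwoSidedIdeal.span {Bt k - 1}).ringCon).mk'

section Aux

variable (k : Type*) [Field k]

/-- The composite `FB → B → B1`. -/
def qq : FB k →+* B1 k :=
  (π k).comp (RingQuot.mkAlgHom (LaurentPolynomial k) (Brel k)).toRingHom

lemma qq_surj : Function.Surjective (qq k) := by
  have h1 : Function.Surjective (π k) := RingCon.mk'_surjective _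
  have h2 := RingQuot.mkAlgHom_surjective (LaurentPolynomial k) (Brel k)
  exact h1.comp h2

lemma qq_t : qq k (algebraMap (LaurentPolynomial k) (FB k) (T 1)) = 1 := by
  have h : Bt k - 1 ∈ TwoSidedIdeal.span {Bt k - 1} :=
    TwoSidedIdeal.subset_span (Set.mem_singleton _)
  have h2 := (TwoSidedIdeal.rel_iff _ (Bt k) 1).mpr h
  have h3 : π k (Bt k) = π k 1 := (RingCon.eq _).mpr h2
  rw [map_one] at h3
  rw [← h3]
  change π k _ = _
  congr 1
  exact AlgHom.commutes _ _

/-- Evaluation at `t = 1`, into the polynomial ring. -/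
def ev : LaurentPolynomial k →+* MvPolynomial (Fin 3) k :=
  LaurentPolynomial.eval₂ MvPolynomial.C 1

lemma ev_T (n : ℤ) : ev k (T n) = 1 := by simp [ev]

lemma ev_C (r : k) : ev k (LaurentPolynomial.C r) = MvPolynomial.C r := by simp [ev]

lemma qq_T (n : ℤ) : qq k (algebraMap (LaurentPolynomial k) (FB k) (T n)) = 1 := by
  set g : LaurentPolynomial k →+* B1 k := (qq k).comp (algebraMap (LaurentPolynomial k) (FB k))
    with hg
  have h1 : g (T 1) = 1 := qq_t k
  have hm : g (T (-1)) = 1 := by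
    have : g (T 1 * T (-1)) = 1 := by rw [← T_add]; simp
    rwa [map_mul, h1, one_mul] at this
  change g (T n) = 1
  rcases n.eq_nat_or_neg with ⟨m, rfl | rfl⟩
  · have := T_pow (R := k) 1 m
    rw [mul_one] at this
    rw [← this, map_pow, h1, one_pow]
  · have := T_pow (R := k) (-1) m
    rw [mul_neg_one] at this
    rw [← this, map_pow, hm, one_pow]

lemma qq_C (r : k) : qq k (algebraMap (LaurentPolynomial k) (FB k) (LaurentPolynomial.C r)) =
    algebraMap k (B1 k) r := by
  change π k _ = π k _
  congr 1
  exact AlgHom.commutes _ _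

lemma qq_rel {x y : FB k} (h : Brel k x y) : qq k x = qq k y := by
  change π k _ = π k _
  congr 1
  exact RingQuot.mkAlgHom_rel _ h

lemma qq_gen (x y : Bgen) :
    Commute (qq k (ι (LaurentPolynomial k) x)) (qq k (ι (LaurentPolynomial k) y)) := by
  have ef := qq_rel k Brel.ef
  have he := qq_rel k Brel.he
  have hf := qq_rel k Brel.hf
  have t := qq_t k
  simp only [map_sub, map_mul, map_neg, map_one, t, sub_self, mul_zero, zero_mul, neg_zero,
    sub_eq_zero] at ef he hf
  cases x <;> cases y <;> first | exact Commute.refl _ | assumption | (symm; assumption)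

lemma qq_scalar (r : LaurentPolynomial k) (z : FB k) :
    Commute (qq k (algebraMap (LaurentPolynomial k) (FB k) r)) (qq k z) := by
  have := Algebra.commutes r z
  simpa [Commute, SemiconjBy] using congrArg (qq k) this

lemma qq_comm (a b : FB k) : Commute (qq k a) (qq k b) := by
  induction a using FreeAlgebra.induction with
  | grade0 r => exact qq_scalar k r b
  | grade1 x =>
    induction b using FreeAlgebra.induction with
    | grade0 r => exact (qq_scalar k r _).symm
    | grade1 y => exact qq_gen k x y
    | mul a b ha hb => rw [map_mul]; exact ha.mul_right hb
    | add a b ha hb => rw [map_add]; exact ha.add_right hb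
  | mul a b ha hb => rw [map_mul]; exact ha.mul_left hb
  | add a b ha hb => rw [map_add]; exact ha.add_left hb

lemma B1_comm (a b : B1 k) : a * b = b * a := by
  obtain ⟨a, rfl⟩ := qq_surj k a
  obtain ⟨b, rfl⟩ := qq_surj k b
  exact qq_comm k a b

/-- The variable attached to a generator. -/
def genX : Bgen → Fin 3
  | .e => 0
  | .f => 1
  | .h => 2

/-- The generator attached to a variable. -/
def genOf : Fin 3 → Bgen := ![.e, .f, .h]

lemma genOf_genX (x : Bgen) : genOf (genX x) = x := by cases x <;> rfl

lemma exists_fwd : ∃ ψ : B1 k →+* MvPolynomial (Fin 3) k,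
    (∀ r, ψ (qq k (algebraMap (LaurentPolynomial k) (FB k) r)) = ev k r) ∧
    ∀ x, ψ (qq k (ι _ x)) = MvPolynomial.X (genX x) := by
  let _ : Algebra (LaurentPolynomial k) (MvPolynomial (Fin 3) k) := (ev k).toAlgebra
  have hal (r : LaurentPolynomial k) :
    algebraMap (LaurentPolynomial k) (MvPolynomial (Fin 3) k) r = ev k r := rfl
  let F : FB k →ₐ[LaurentPolynomial k] MvPolynomial (Fin 3) k :=
    FreeAlgebra.lift _ (fun x => MvPolynomial.X (genX x))
  have hF (x) : F (ι _ x) = MvPolynomial.X (genX x) := FreeAlgebra.lift_ι_apply _ _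
  have hr : ∀ ⦃x y⦄, Brel k x y → F x = F y := by
    intro x y h
    cases h <;>
    · simp only [map_sub, map_mul, map_neg, AlgHom.commutes, hal, ev_T, map_one, sub_self, mul_zero,
        zero_mul, neg_zero]
      ring
  let G := RingQuot.liftAlgHom (LaurentPolynomial k) ⟨F, hr⟩
  have hG (x) : G (RingQuot.mkAlgHom (LaurentPolynomial k) (Brel k) x) = F x :=
    RingQuot.liftAlgHom_mkAlgHom_apply _ _ _ _
  have hle : (TwoSidedIdeal.span {Bt k - 1}).ringCon ≤ RingCon.ker G.toRingHom := by
    have h := TwoSidedIdeal.span_le (s := {Bt k - 1}) (I := TwoSidedIdeal.ker G.toRingHom) |>.2 (by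
      rw [Set.singleton_subset_iff, SetLike.mem_coe, TwoSidedIdeal.mem_ker]
      change G (Bt k - 1) = 0
      have hh : G (Bt k) = G 1 := by rw [map_one, Bt, AlgHom.commutes, hal, ev_T]
      exact (map_sub G (Bt k) 1).trans (sub_eq_zero.2 hh))
    exact TwoSidedIdeal.ringCon_le_iff.1 h
  refine ⟨RingCon.lift _ G.toRingHom hle, fun r => ?_, fun x => ?_⟩
  · change G (RingQuot.mkAlgHom (LaurentPolynomial k) (Brel k) _) = _
    rw [hG, AlgHom.commutes, hal]
  · change G (RingQuot.mkAlgHom (LaurentPolynomial k) (Brel k) _) = _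
    rw [hG, hF]

lemma exists_bwd : ∃ g : MvPolynomial (Fin 3) k →+* B1 k,
    (∀ r, g (MvPolynomial.C r) = algebraMap k (B1 k) r) ∧
    ∀ i, g (MvPolynomial.X i) = qq k (ι _ (genOf i)) := by
  let _ : CommRing (B1 k) := { (inferInstance : Ring (B1 k)) with mul_comm := B1_comm k }
  exact ⟨MvPolynomial.eval₂Hom (algebraMap k (B1 k)) (fun i => qq k (ι _ (genOf i))),
    fun r => MvPolynomial.eval₂Hom_C _ _ _, fun i => MvPolynomial.eval₂Hom_X' _ _ _⟩

lemma exists_equiv : ∃ φ : B1 k ≃ₐ[k] MvPolynomial (Fin 3) k,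
    ∀ x, φ (qq k (ι _ x)) = MvPolynomial.X (genX x) := by
  obtain ⟨ψ, h0, h1⟩ := exists_fwd k
  obtain ⟨g, g0, g1⟩ := exists_bwd k
  have hk (r : k) : ψ (algebraMap k (B1 k) r) = MvPolynomial.C r := by
    rw [← qq_C, h0, ev_C]
  have hl : ∀ z, g (ψ z) = z := by
    intro z
    obtain ⟨z, rfl⟩ := qq_surj k z
    induction z using FreeAlgebra.induction with
    | grade0 r =>
      rw [h0]
      induction r using LaurentPolynomial.induction_on' with
      | add p q hp hq => simp only [map_add, hp, hq]
      | C_mul_T n a => simp only [map_mul, ev_T, ev_C, qq_T, qq_C, g0, map_one]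
    | grade1 x => rw [h1, g1, genOf_genX]
    | mul a b ha hb => simp only [map_mul, ha, hb]
    | add a b ha hb => simp only [map_add, ha, hb]
  have hr : ∀ p, ψ (g p) = p := by
    intro p
    induction p using MvPolynomial.induction_on with
    | C r => rw [g0, hk]
    | add p q hp hq => simp only [map_add, hp, hq]
    | mul_X p i hp =>
      rw [map_mul, map_mul, hp, g1, h1]
      congr 2
      fin_cases i <;> rfl
  exact ⟨AlgEquiv.ofRingEquiv (f := RingEquiv.ofRingHom ψ g (RingHom.ext hr) (RingHom.ext hl)) hk,
    h1⟩

end Aux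

open MvPolynomial in
/-- `B/(t−1)B` is commutative, and there is a `k`-algebra isomorphism
from `B/(t−1)B` onto the polynomial ring `k[e,f,h]` sending the images of the
generators `e, f, h` of `B` to the corresponding variables. -/
theorem B1_commutative_and_iso_polynomial :
    (∀ a b : B1 k, a * b = b * a) ∧
    ∃ φ : B1 k ≃ₐ[k] MvPolynomial (Fin 3) k,
      φ (π k (Be k)) = X 0 ∧ φ (π k (Bf k)) = X 1 ∧ φ (π k (Bh k)) = X 2 := by

  obtain ⟨φ, h⟩ := exists_equiv k
  exact ⟨B1_comm k, φ, h .e, h .f, h .h⟩
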